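/- Let 0 → Y →ι X →π Z → 0 be an exact sequence of Banach spaces and bounded operators, let t : Y → B be a bounded operator, and let 0 → B →ι′ PO →ϖ Z → 0 be the associated push-out sequence. Then the push-out sequence splits (i.e., there exists a bounded operator P : PO → B with P ∘ ι′ = id_B) if and only if t extends to X, that is, there exists a bounded operator T : X → B with T ∘ ι = t. -/

import Mathlib

/-!
Splitting criterion: the push-out sequence associated to an exact sequence
`0 → Y → X → Z → 0` and an operator `t : Y → B` splits iff `t` extends to `X`.
-/

noncomputable section

open scoped ENNReal

variable {Y A B C : Type*}
  [NormedAddCommGroup Y] [NormedSpace ℂ Y]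
  [NormedAddCommGroup A] [NormedSpace ℂ A]
  [NormedAddCommGroup B] [NormedSpace ℂ B]

/-- The (closure of the) subspace `{(α y, -β y) : y ∈ Y}` of `A ⊕₁ B`. -/
def poSub (α : Y →L[ℂ] A) (β : Y →L[ℂ] B) : Submodule ℂ (WithLp 1 (A × B)) :=
  (LinearMap.range
    ((WithLp.linearEquiv 1 ℂ (A × B)).symm.toLinearMap.comp
      ((α : Y →ₗ[ℂ] A).prod (-(β : Y →ₗ[ℂ] B))))).topologicalClosure

/-- The push-out space `PO(α, β) = (A ⊕₁ B) / S̄`. -/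
def PO (α : Y →L[ℂ] A) (β : Y →L[ℂ] B) : Type _ :=
  WithLp 1 (A × B) ⧸ poSub α β

instance poSub_isClosed (α : Y →L[ℂ] A) (β : Y →L[ℂ] B) :
    IsClosed ((poSub α β : Submodule ℂ (WithLp 1 (A × B))) : Set (WithLp 1 (A × B))) :=
  Submodule.isClosed_topologicalClosure _

instance (α : Y →L[ℂ] A) (β : Y →L[ℂ] B) : NormedAddCommGroup (PO α β) :=
  inferInstanceAs (NormedAddCommGroup (WithLp 1 (A × B) ⧸ poSub α β))

instance (α : Y →L[ℂ] A) (β : Y →L[ℂ] B) : NormedSpace ℂ (PO α β) :=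
  inferInstanceAs (NormedSpace ℂ (WithLp 1 (A × B) ⧸ poSub α β))

/-- The class of `(a, b)` in the push-out. -/
def poMk (α : Y →L[ℂ] A) (β : Y →L[ℂ] B) (x : A × B) : PO α β :=
  (Submodule.Quotient.mk ((WithLp.equiv 1 (A × B)).symm x) : WithLp 1 (A × B) ⧸ poSub α β)

/-- The canonical map `A → PO(α, β)`, `a ↦ (a, 0) + S̄`. -/
def poInl (α : Y →L[ℂ] A) (β : Y →L[ℂ] B) (a : A) : PO α β := poMk α β (a, 0)

/-- The canonical map `B → PO(α, β)`, `b ↦ (0, b) + S̄`. -/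
def poInr (α : Y →L[ℂ] A) (β : Y →L[ℂ] B) (b : B) : PO α β := poMk α β (0, b)

/-- The quotient map `A ⊕₁ B → PO(α, β)` as a bounded operator on `A × B`. -/
def poMkL (α : Y →L[ℂ] A) (β : Y →L[ℂ] B) : A × B →L[ℂ] PO α β :=
  (poSub α β).mkQL ∘L
    ((WithLp.prodContinuousLinearEquiv 1 ℂ A B).symm : A × B →L[ℂ] WithLp 1 (A × B))

theorem poMkL_apply (α : Y →L[ℂ] A) (β : Y →L[ℂ] B) (x : A × B) :
    poMkL α β x = poMk α β x := rfl

theorem poMk_apply_neg (α : Y →L[ℂ] A) (β : Y →L[ℂ] B) (y : Y) :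
    poMk α β (α y, -β y) = 0 :=
  (Submodule.Quotient.mk_eq_zero _).2 (Submodule.le_topologicalClosure _ ⟨y, rfl⟩)

/-- The push-out square commutes. -/
theorem poInl_apply_eq_poInr (α : Y →L[ℂ] A) (β : Y →L[ℂ] B) (y : Y) :
    poInl α β (α y) = poInr α β (β y) := by
  have h := poMk_apply_neg α β y
  rw [← sub_eq_zero, poInl, poInr, ← poMkL_apply, ← poMkL_apply, ← map_sub]
  simpa [poMkL_apply] using h

theorem poSub_le_ker {C : Type*} [NormedAddCommGroup C] [NormedSpace ℂ C]
    (α : Y →L[ℂ] A) (β : Y →L[ℂ] B) (f : WithLp 1 (A × B) →L[ℂ] C)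
    (hf : ∀ y : Y, f (WithLp.toLp 1 (α y, -β y)) = 0) : poSub α β ≤ f.ker := by
  refine Submodule.topologicalClosure_minimal _ ?_ f.isClosed_ker
  rintro _ ⟨y, rfl⟩
  exact hf y

/-- The universal property of the push-out: operators `f` and `g` with `f ∘ α = g ∘ β` induce an
operator on `PO(α, β)`. -/
def poDesc {C : Type*} [NormedAddCommGroup C] [NormedSpace ℂ C]
    (α : Y →L[ℂ] A) (β : Y →L[ℂ] B) (f : A →L[ℂ] C) (g : B →L[ℂ] C)
    (h : ∀ y : Y, f (α y) = g (β y)) : PO α β →L[ℂ] C :=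
  (poSub α β).liftQL
    (f.coprod g ∘L (WithLp.prodContinuousLinearEquiv 1 ℂ A B : WithLp 1 (A × B) →L[ℂ] A × B))
    (poSub_le_ker α β _ fun y => by simp [h])

theorem poDesc_poInr {C : Type*} [NormedAddCommGroup C] [NormedSpace ℂ C]
    (α : Y →L[ℂ] A) (β : Y →L[ℂ] B) (f : A →L[ℂ] C) (g : B →L[ℂ] C)
    (h : ∀ y : Y, f (α y) = g (β y)) (b : B) : poDesc α β f g h (poInr α β b) = g b := by
  change f 0 + g b = g b
  simp

/-- **Splitting criterion for the push-out sequence** (Lemma `crit-po`).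
Given an exact sequence `0 → Y →ι X →π Z → 0` of Banach spaces and a bounded
operator `t : Y → B`, the push-out sequence `0 → B →ι' PO →ϖ Z → 0` splits
(i.e. `ι'` admits a bounded left inverse) if and only if `t` extends to `X`. -/
theorem pushout_splits_iff_extends
    {X Z : Type*} [NormedAddCommGroup X] [NormedSpace ℂ X]
    [NormedAddCommGroup Z] [NormedSpace ℂ Z]
    [CompleteSpace Y] [CompleteSpace X] [CompleteSpace B] [CompleteSpace Z]
    (ι : Y →L[ℂ] X) (π : X →L[ℂ] Z) (t : Y →L[ℂ] B)
    (hemb : ∃ c : ℝ, 0 < c ∧ ∀ y : Y, c * ‖y‖ ≤ ‖ι y‖)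
    (hker : ∀ x : X, (∃ y : Y, ι y = x) ↔ π x = 0)
    (hsurj : Function.Surjective π) :
    (∃ P : PO ι t →L[ℂ] B, ∀ b : B, P (poInr ι t b) = b) ↔
      (∃ T : X →L[ℂ] B, ∀ y : Y, T (ι y) = t y) := by
  constructor
  · rintro ⟨P, hP⟩
    refine ⟨P ∘L poMkL ι t ∘L ContinuousLinearMap.inl ℂ X B, fun y => ?_⟩
    change P (poInl ι t (ι y)) = t y
    rw [poInl_apply_eq_poInr, hP]
  · rintro ⟨T, hT⟩
    exact ⟨poDesc ι t T (ContinuousLinearMap.id ℂ B) hT, poDesc_poInr ι t T _ hT⟩
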